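/- Every element of the set G is a constant of δ lying in the commutator ideal: for each g ∈ G one has g ∈ F_{2d}' and δ(g) = 0. In particular δ([x_i,y_i]) = 0, δ([x_i,x_j]) = 0, δ([x_i,y_j] + [x_j,y_i]) = 0, δ([x_i,x_p,y_q] − [x_i,y_p,x_q]) = 0, δ([x_i,x_j,y_k] − [x_i,x_k,y_j] + [x_j,x_k,y_i]) = 0, and δ([x_i,x_p,y_j,y_q] + [y_i,y_p,x_j,x_q] − [x_i,y_p,y_j,x_q] − [y_i,x_p,x_j,y_q]) = 0 for all admissible indices. -/

import Mathlib

noncomputable section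

/-- The free metabelian Lie algebra of rank `2d` over `K`: the quotient of the free Lie
algebra on `x₁,…,x_d,y₁,…,y_d` (indexed by `Fin d ⊕ Fin d`) by its second derived ideal. -/
abbrev FreeMetabelian (K : Type*) [Field K] (d : ℕ) :=
  FreeLieAlgebra K (Fin d ⊕ Fin d) ⧸
    LieAlgebra.derivedSeries K (FreeLieAlgebra K (Fin d ⊕ Fin d)) 2

variable (K : Type*) [Field K] (d : ℕ)

/-- The image of the free generator `xᵢ` in the free metabelian Lie algebra. -/
def xL (i : Fin d) : FreeMetabelian K d :=
  LieSubmodule.Quotient.mk' _ (FreeLieAlgebra.of K (Sum.inl i))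

/-- The image of the free generator `yᵢ` in the free metabelian Lie algebra. -/
def yL (i : Fin d) : FreeMetabelian K d :=
  LieSubmodule.Quotient.mk' _ (FreeLieAlgebra.of K (Sum.inr i))


/-- The set `G` of Lie constants from the Corollary. -/
def Gset : Set (FreeMetabelian K d) :=
  (Set.range fun i : Fin d => ⁅xL K d i, yL K d i⁆) ∪
  {g | ∃ i j : Fin d, i < j ∧ g = ⁅xL K d i, xL K d j⁆} ∪
  {g | ∃ i j : Fin d, i < j ∧ g = ⁅xL K d i, yL K d j⁆ + ⁅xL K d j, yL K d i⁆} ∪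
  {g | ∃ i p q : Fin d, p < q ∧
    g = ⁅⁅xL K d i, xL K d p⁆, yL K d q⁆ - ⁅⁅xL K d i, yL K d p⁆, xL K d q⁆} ∪
  {g | ∃ i j k : Fin d, i < j ∧ j < k ∧
    g = ⁅⁅xL K d i, xL K d j⁆, yL K d k⁆ - ⁅⁅xL K d i, xL K d k⁆, yL K d j⁆
      + ⁅⁅xL K d j, xL K d k⁆, yL K d i⁆} ∪
  {g | ∃ i j p q : Fin d, i < j ∧ p < q ∧
    g = ⁅⁅⁅xL K d i, xL K d p⁆, yL K d j⁆, yL K d q⁆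
      + ⁅⁅⁅yL K d i, yL K d p⁆, xL K d j⁆, xL K d q⁆
      - ⁅⁅⁅xL K d i, yL K d p⁆, yL K d j⁆, xL K d q⁆
      - ⁅⁅⁅yL K d i, xL K d p⁆, xL K d j⁆, yL K d q⁆}

/-- A bracket of two elements lies in the first term of the derived series. -/
theorem lie_mem_derivedSeries_one {R L : Type*} [CommRing R] [LieRing L] [LieAlgebra R L]
    (a b : L) : ⁅a, b⁆ ∈ LieAlgebra.derivedSeries R L 1 := by
  rw [LieAlgebra.derivedSeries_def, LieAlgebra.derivedSeriesOfIdeal_succ,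
    LieAlgebra.derivedSeriesOfIdeal_zero]
  exact LieSubmodule.lie_mem_lie (LieSubmodule.mem_top a) (LieSubmodule.mem_top b)

/-- Every element of `G` lies in the commutator ideal `F_{2d}'` and is a constant of the
Weitzenböck derivation `δ` (`δ(xᵢ) = 0`, `δ(yᵢ) = xᵢ`). -/
theorem Gset_subset_constants (K : Type*) [Field K] [CharZero K] (d : ℕ) (hd : 2 ≤ d)
    (δ : LieDerivation K (FreeMetabelian K d) (FreeMetabelian K d))
    (hx : ∀ i : Fin d, δ (xL K d i) = 0)
    (hy : ∀ i : Fin d, δ (yL K d i) = xL K d i) :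
    ∀ g ∈ Gset K d,
      g ∈ LieAlgebra.derivedSeries K (FreeMetabelian K d) 1 ∧ δ g = 0 := by
  have hm := fun a b : FreeMetabelian K d => lie_mem_derivedSeries_one (R := K) a b
  rintro g (((((⟨i, rfl⟩ | ⟨i, j, -, rfl⟩) | ⟨i, j, -, rfl⟩) | ⟨i, p, q, -, rfl⟩) |
    ⟨i, j, k, -, -, rfl⟩) | ⟨i, j, p, q, -, -, rfl⟩)
  · exact ⟨hm _ _, by simp [hx, hy]⟩
  · exact ⟨hm _ _, by simp [hx]⟩
  · refine ⟨add_mem (hm _ _) (hm _ _), ?_⟩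
    rw [map_add, LieDerivation.apply_lie_eq_add, LieDerivation.apply_lie_eq_add]
    simp only [hx, hy, zero_lie, add_zero]
    rw [← lie_skew, neg_add_cancel]
  · refine ⟨sub_mem (hm _ _) (hm _ _), ?_⟩
    simp only [map_sub, LieDerivation.apply_lie_eq_add, hx, hy, zero_lie, lie_zero, add_zero,
      zero_add, sub_self]
  · refine ⟨add_mem (sub_mem (hm _ _) (hm _ _)) (hm _ _), ?_⟩
    simp only [map_add, map_sub, LieDerivation.apply_lie_eq_add, hx, hy, zero_lie, lie_zero,
      add_zero]
    rw [lie_lie (xL K d i) (xL K d j), ← lie_skew ⁅xL K d i, xL K d k⁆,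
      ← lie_skew ⁅xL K d j, xL K d k⁆]
    abel
  · refine ⟨sub_mem (sub_mem (add_mem (hm _ _) (hm _ _)) (hm _ _)) (hm _ _), ?_⟩
    simp only [map_add, map_sub, LieDerivation.apply_lie_eq_add, hx, hy, zero_lie, lie_zero,
      add_zero, zero_add, add_lie]
    abel

end
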